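/- For every t ∈ [0,T], the backward reachable set ℛ_t equals the zero sub-level set of the value function: ℛ_t = {x ∈ ℝ^n : u(x,t) ≤ 0}, where ℛ_t := {x ∈ ℝ^n : for every admissible uncertainty d on [t,T], the unique maximal solution y of ẏ(s) = f(y(s), d(s)) with y(t) = x is defined on all of [t,T], satisfies y(s) ∈ X_s for every s ∈ [t,T], and satisfies y(T) ∈ TR}. -/

import Mathlib

open Set MeasureTheory RealInnerProductSpace Filter Topology

noncomputable section

abbrev EucSp (n : ℕ) : Type := EuclideanSpace ℝ (Fin n)

/-- An admissible uncertainty on `[t, T]`: a measurable map taking values in `D` there. -/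
def Admissible {m : ℕ} (D : Set (EucSp m)) (t T : ℝ) (d : ℝ → EucSp m) : Prop :=
  Measurable d ∧ ∀ s ∈ Set.Icc t T, d s ∈ D

/-- `y` solves `ẏ(s) = F (y s) (d s)` on `[t, T]` with `y t = x` (integral form,
equivalent to absolute continuity together with the a.e. differential equation). -/
def IsTraj {n m : ℕ} (F : EucSp n → EucSp m → EucSp n) (d : ℝ → EucSp m)
    (t T : ℝ) (x : EucSp n) (y : ℝ → EucSp n) : Prop :=
  y t = x ∧ ∀ s ∈ Set.Icc t T, y s = x + ∫ r in t..s, F (y r) (d r)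

/-- The payoff of a trajectory `y` on `[t, T]`:
`max { max_j l_j (y T), max_i sup_{s ∈ [t,T]} g_i (y s, s) }`. -/
def payoff {n nX nTR : ℕ} (g : Fin nX → EucSp n → ℝ → ℝ) (l : Fin nTR → EucSp n → ℝ)
    (t T : ℝ) (y : ℝ → EucSp n) : ℝ :=
  max (⨆ j, l j (y T)) (⨆ i, sSup ((fun s => g i (y s) s) '' Set.Icc t T))

/-- The defining property of the value function `u`: for `(x, t) ∈ ℝⁿ × [0, T]`,
`u (x, t)` is the supremum of the payoffs over all admissible uncertainties on `[t, T]`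
(the trajectory being the unique solution of the ODE driven by the uncertainty). -/
def IsValueFun {n m nX nTR : ℕ} (F : EucSp n → EucSp m → EucSp n) (D : Set (EucSp m))
    (g : Fin nX → EucSp n → ℝ → ℝ) (l : Fin nTR → EucSp n → ℝ) (T : ℝ)
    (u : EucSp n → ℝ → ℝ) : Prop :=
  ∀ x : EucSp n, ∀ t ∈ Set.Icc (0:ℝ) T,
    u x t = sSup {r | ∃ d y, Admissible D t T d ∧ IsTraj F d t T x y ∧
      r = payoff g l t T y}

/-- The Hamiltonian `H(x, p) = max_{d ∈ D} ⟪p, F x d⟫`. -/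
def Ham {n m : ℕ} (F : EucSp n → EucSp m → EucSp n) (D : Set (EucSp m))
    (x p : EucSp n) : ℝ :=
  sSup ((fun d => ⟪p, F x d⟫) '' D)

/-- Viscosity super-solution of `max{∂ₜ w + H(x, ∇ₓ w), maxᵢ gᵢ(x,t) - w} = 0` on
`ℝⁿ × [0, T]`: a lower semicontinuous function such that for every smooth test function
`ψ` such that `w - ψ` attains a local minimum at `(x₀, t₀) ∈ ℝⁿ × [0, T]`, one has
`max{∂ₜ ψ(x₀,t₀) + H(x₀, ∇ₓ ψ(x₀,t₀)), maxᵢ gᵢ(x₀,t₀) - w(x₀,t₀)} ≤ 0`. -/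
def ViscSuper {n m nX : ℕ} (F : EucSp n → EucSp m → EucSp n) (D : Set (EucSp m))
    (g : Fin nX → EucSp n → ℝ → ℝ) (T : ℝ) (w : EucSp n → ℝ → ℝ) : Prop :=
  LowerSemicontinuousOn (fun p : EucSp n × ℝ => w p.1 p.2) (Set.univ ×ˢ Set.Icc 0 T) ∧
  ∀ ψ : EucSp n → ℝ → ℝ, ContDiff ℝ (⊤ : ℕ∞) (fun p : EucSp n × ℝ => ψ p.1 p.2) →
    ∀ x₀ : EucSp n, ∀ t₀ ∈ Set.Icc (0:ℝ) T,
      IsLocalMinOn (fun p : EucSp n × ℝ => w p.1 p.2 - ψ p.1 p.2)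
        (Set.univ ×ˢ Set.Icc 0 T) (x₀, t₀) →
      max (deriv (ψ x₀) t₀ + Ham F D x₀ (gradient (fun z => ψ z t₀) x₀))
        ((⨆ i, g i x₀ t₀) - w x₀ t₀) ≤ 0

/-- Viscosity sub-solution of `max{∂ₜ w + H(x, ∇ₓ w), maxᵢ gᵢ(x,t) - w} = 0` on
`ℝⁿ × [0, T]`. -/
def ViscSub {n m nX : ℕ} (F : EucSp n → EucSp m → EucSp n) (D : Set (EucSp m))
    (g : Fin nX → EucSp n → ℝ → ℝ) (T : ℝ) (w : EucSp n → ℝ → ℝ) : Prop :=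
  UpperSemicontinuousOn (fun p : EucSp n × ℝ => w p.1 p.2) (Set.univ ×ˢ Set.Icc 0 T) ∧
  ∀ ψ : EucSp n → ℝ → ℝ, ContDiff ℝ (⊤ : ℕ∞) (fun p : EucSp n × ℝ => ψ p.1 p.2) →
    ∀ x₀ : EucSp n, ∀ t₀ ∈ Set.Icc (0:ℝ) T,
      IsLocalMaxOn (fun p : EucSp n × ℝ => w p.1 p.2 - ψ p.1 p.2)
        (Set.univ ×ˢ Set.Icc 0 T) (x₀, t₀) →
      0 ≤ max (deriv (ψ x₀) t₀ + Ham F D x₀ (gradient (fun z => ψ z t₀) x₀))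
        ((⨆ i, g i x₀ t₀) - w x₀ t₀)

/-- The backward reachable set at time `t` (horizon `T`) of the target `{maxⱼ lⱼ ≤ 0}`
under state constraints `{maxᵢ gᵢ(·, s) ≤ 0}`, for the dynamics `f` driven by
uncertainties in `D`: the set of `x` such that for every admissible uncertainty the
(unique) solution extends to all of `[t, T]`, respects the state constraints there,
and ends up in the target at time `T`. -/
def Reach {n m nX nTR : ℕ} (f : EucSp n → EucSp m → EucSp n) (D : Set (EucSp m))
    (g : Fin nX → EucSp n → ℝ → ℝ) (l : Fin nTR → EucSp n → ℝ)
    (t T : ℝ) : Set (EucSp n) :=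
  {x | ∀ d, Admissible D t T d → ∃ y, IsTraj f d t T x y ∧
    (∀ s ∈ Set.Icc t T, ∀ i, g i (y s) s ≤ 0) ∧ ∀ j, l j (y T) ≤ 0}

theorem le_mul_exp_of_le_add_mul_integral {w : ℝ → ℝ} {t T δ K : ℝ} (hK : 0 ≤ K)
    (hw : ContinuousOn w (Icc t T))
    (h : ∀ s ∈ Icc t T, w s ≤ δ + K * ∫ r in t..s, w r) :
    ∀ s ∈ Icc t T, w s ≤ δ * Real.exp (K * (s - t)) := by
  intro s hs
  have htT : t ≤ T := hs.1.trans hs.2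
  have hwi : IntervalIntegrable w volume t T := hw.intervalIntegrable_of_Icc htT
  have hcont : ContinuousOn (fun s => δ + K * ∫ r in t..s, w r) (Icc t T) := by
    have := intervalIntegral.continuousOn_primitive_interval' hwi left_mem_uIcc
    rw [uIcc_of_le htT] at this
    exact continuousOn_const.add (continuousOn_const.mul this)
  have hder : ∀ a ∈ Ico t T,
      HasDerivWithinAt (fun s => δ + K * ∫ r in t..s, w r) (K * w a) (Ici a) a := by
    intro a ha
    have hnhds : Icc t T ∈ 𝓝[>] a :=
      mem_of_superset (Icc_mem_nhdsGT ha.2) (Icc_subset_Icc_left ha.1)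
    have hwa : IntervalIntegrable w volume t a :=
      hwi.mono_set (by rw [uIcc_of_le ha.1, uIcc_of_le htT]; exact Icc_subset_Icc_right ha.2.le)
    have hca : ContinuousWithinAt w (Ioi a) a :=
      (hw a (Ico_subset_Icc_self ha)).mono_of_mem_nhdsWithin hnhds
    have hmeas : StronglyMeasurableAtFilter w (𝓝[>] a) :=
      ⟨Icc t T, hnhds, hw.aestronglyMeasurable measurableSet_Icc⟩
    exact ((intervalIntegral.integral_hasDerivWithinAt_right hwa hmeas hca).const_mul
      K).const_add δ
  have hgron := le_gronwallBound_of_liminf_deriv_right_le (δ := δ) (K := K) (ε := 0) hcont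
    (fun a ha r hr => (hder a ha).liminf_right_slope_le hr) (by simp)
    (fun a ha => by
      simpa using mul_le_mul_of_nonneg_left (h a (Ico_subset_Icc_self ha)) hK) s hs
  rw [gronwallBound_ε0] at hgron
  exact (h s hs).trans hgron

section Trajectories

variable {n m : ℕ} {F : EucSp n → EucSp m → EucSp n} {D : Set (EucSp m)} {LF t T : ℝ}
  {d : ℝ → EucSp m} {x : EucSp n} {y z : ℝ → EucSp n}

theorem exists_norm_le_of_norm_sub_le
    (hFcont : Continuous fun p : EucSp n × EucSp m => F p.1 p.2) (hDcomp : IsCompact D)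
    (x : EucSp n) (C : ℝ) :
    ∃ M, 0 ≤ M ∧ ∀ a b, ‖a - x‖ ≤ C → b ∈ D → ‖F a b‖ ≤ M := by
  obtain ⟨M, hM⟩ := ((isCompact_closedBall x C).prod hDcomp).exists_bound_of_continuousOn
    hFcont.continuousOn
  refine ⟨max M 0, le_max_right _ _, fun a b ha hb => le_max_of_le_left (hM (a, b) ⟨?_, hb⟩)⟩
  rwa [mem_closedBall_iff_norm]

theorem Admissible.integrableOn_comp
    (hFcont : Continuous fun p : EucSp n × EucSp m => F p.1 p.2) (hDcomp : IsCompact D)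
    (hd : Admissible D t T d) {C : ℝ}
    (hy : AEStronglyMeasurable y (volume.restrict (Icc t T)))
    (hyC : ∀ r ∈ Icc t T, ‖y r - x‖ ≤ C) :
    IntegrableOn (fun r => F (y r) (d r)) (Icc t T) := by
  obtain ⟨M, -, hM⟩ := exists_norm_le_of_norm_sub_le hFcont hDcomp x C
  refine Integrable.of_bound
    (hFcont.comp_aestronglyMeasurable₂ hy hd.1.aestronglyMeasurable) M ?_
  filter_upwards [ae_restrict_mem measurableSet_Icc] with r hr
  exact hM _ _ (hyC r hr) (hd.2 r hr)

theorem Admissible.integrableOn_comp_of_continuousOn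
    (hFcont : Continuous fun p : EucSp n × EucSp m => F p.1 p.2) (hDcomp : IsCompact D)
    (hd : Admissible D t T d) (hy : ContinuousOn y (Icc t T)) :
    IntegrableOn (fun r => F (y r) (d r)) (Icc t T) := by
  obtain ⟨C, hC⟩ := isCompact_Icc.exists_bound_of_continuousOn hy
  exact hd.integrableOn_comp (x := 0) hFcont hDcomp (hy.aestronglyMeasurable measurableSet_Icc)
    (by simpa using hC)

theorem continuousOn_intervalIntegral_Icc {φ : ℝ → EucSp n} (hφ : IntegrableOn φ (Icc t T)) :
    ContinuousOn (fun s => ∫ r in t..s, φ r) (Icc t T) :=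
  (intervalIntegral.continuousOn_primitive hφ).congr fun _ hs =>
    intervalIntegral.integral_of_le hs.1

theorem IsTraj.continuousOn (h : IsTraj F d t T x y)
    (hint : IntegrableOn (fun r => F (y r) (d r)) (Icc t T)) : ContinuousOn y (Icc t T) := by
  refine ContinuousOn.congr ?_ h.2
  exact continuousOn_const.add (continuousOn_intervalIntegral_Icc hint)

theorem IsTraj.mono (h : IsTraj F d t T x y) {s : ℝ} (hs : s ≤ T) : IsTraj F d t s x y :=
  ⟨h.1, fun r hr => h.2 r (Icc_subset_Icc_right hs hr)⟩

theorem Admissible.mono (h : Admissible D t T d) {s : ℝ} (hs : s ≤ T) : Admissible D t s d :=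
  ⟨h.1, fun r hr => h.2 r (Icc_subset_Icc_right hs hr)⟩

theorem IsTraj.norm_sub_le_of_integrableOn (hLF : 0 ≤ LF)
    (hFlip : ∀ x y : EucSp n, ∀ d ∈ D, ‖F x d - F y d‖ ≤ LF * ‖x - y‖)
    {M : ℝ} (hM0 : 0 ≤ M) (hM : ∀ b ∈ D, ‖F x b‖ ≤ M)
    (hd : Admissible D t T d) (h : IsTraj F d t T x y)
    (hint : IntegrableOn (fun r => F (y r) (d r)) (Icc t T)) :
    ∀ s ∈ Icc t T, ‖y s - x‖ ≤ M * (T - t) * Real.exp (LF * (s - t)) := by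
  have hc : ContinuousOn (fun s => ‖y s - x‖) (Icc t T) :=
    ((h.continuousOn hint).sub continuousOn_const).norm
  refine le_mul_exp_of_le_add_mul_integral hLF hc fun s hs => ?_
  have hwi : IntervalIntegrable (fun r => ‖y r - x‖) volume t s :=
    (hc.mono (Icc_subset_Icc_right hs.2)).intervalIntegrable_of_Icc hs.1
  calc ‖y s - x‖ = ‖∫ r in t..s, F (y r) (d r)‖ := by rw [h.2 s hs]; simp
    _ ≤ ∫ r in t..s, (M + LF * ‖y r - x‖) := by
      refine intervalIntegral.norm_integral_le_of_norm_le hs.1 (ae_of_all _ fun r hr => ?_)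
        (intervalIntegrable_const.add (hwi.const_mul LF))
      have hrD : d r ∈ D := hd.2 r ⟨hr.1.le, hr.2.trans hs.2⟩
      calc ‖F (y r) (d r)‖ = ‖F x (d r) + (F (y r) (d r) - F x (d r))‖ := by congr 1; abel
        _ ≤ _ := (norm_add_le _ _).trans (add_le_add (hM _ hrD) (hFlip _ _ _ hrD))
    _ = M * (s - t) + LF * ∫ r in t..s, ‖y r - x‖ := by
      rw [intervalIntegral.integral_add intervalIntegrable_const (hwi.const_mul LF)]
      simp [mul_comm]
    _ ≤ M * (T - t) + LF * ∫ r in t..s, ‖y r - x‖ := by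
      gcongr
      exact hs.2

/-- A trajectory cannot leave the a priori bound, nor can its integrand fail to be integrable:
past a failure of integrability the Bochner integral vanishes, so `y` would return to `x`. -/
theorem IsTraj.norm_sub_le_and_integrableOn (hLF : 0 ≤ LF)
    (hFcont : Continuous fun p : EucSp n × EucSp m => F p.1 p.2) (hDcomp : IsCompact D)
    (hFlip : ∀ x y : EucSp n, ∀ d ∈ D, ‖F x d - F y d‖ ≤ LF * ‖x - y‖)
    {M : ℝ} (hM0 : 0 ≤ M) (hM : ∀ b ∈ D, ‖F x b‖ ≤ M)
    (hd : Admissible D t T d) (h : IsTraj F d t T x y) :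
    (∀ s ∈ Icc t T, ‖y s - x‖ ≤ M * (T - t) * Real.exp (LF * (T - t))) ∧
      IntegrableOn (fun r => F (y r) (d r)) (Icc t T) := by
  set A : Set ℝ := {s | s ∈ Icc t T ∧ IntegrableOn (fun r => F (y r) (d r)) (Icc t s)}
  have hAcont : ∀ s ∈ A, ContinuousOn y (Icc t s) := fun s hs =>
    (h.mono hs.1.2).continuousOn hs.2
  have hAlower : ∀ s ∈ A, Icc t s ⊆ A := fun s hs r hr =>
    ⟨⟨hr.1, hr.2.trans hs.1.2⟩, hs.2.mono_set (Icc_subset_Icc_right hr.2)⟩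
  have hcompl : ∀ s ∈ Icc t T, s ∉ A → y s = x := by
    intro s hs hsA
    rw [h.2 s hs, intervalIntegral.integral_undef, add_zero]
    intro hi
    exact hsA ⟨hs, (intervalIntegrable_iff_integrableOn_Icc_of_le hs.1).1 hi⟩
  have hbound : ∀ s ∈ Icc t T, ‖y s - x‖ ≤ M * (T - t) * Real.exp (LF * (T - t)) := by
    intro s hs
    have htT : 0 ≤ T - t := sub_nonneg.2 (hs.1.trans hs.2)
    by_cases hsA : s ∈ A
    · refine ((h.mono hs.2).norm_sub_le_of_integrableOn hLF hFlip hM0 hM (hd.mono hs.2) hsA.2 s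
        ⟨hs.1, le_rfl⟩).trans ?_
      have := hs.2
      gcongr
    · rw [hcompl s hs hsA, sub_self, norm_zero]
      positivity
  have hAord : A.OrdConnected :=
    ⟨fun a ha b hb r hr => hAlower b hb ⟨ha.1.1.trans hr.1, hr.2⟩⟩
  have hAc : ContinuousOn y A := by
    intro s hs
    by_cases hmax : ∃ s' ∈ A, s < s'
    · obtain ⟨s', hs', hlt⟩ := hmax
      refine ((hAcont s' hs') s ⟨hs.1.1, hlt.le⟩).mono_of_mem_nhdsWithin ?_
      filter_upwards [self_mem_nhdsWithin, mem_nhdsWithin_of_mem_nhds (Iio_mem_nhds hlt)]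
        with r hr hrs
      exact ⟨hr.1.1, le_of_lt hrs⟩
    · push Not at hmax
      exact ((hAcont s hs) s ⟨hs.1.1, le_rfl⟩).mono fun r hr => ⟨hr.1.1, hmax r hr⟩
  have hmeas : AEStronglyMeasurable y (volume.restrict (Icc t T)) := by
    have hsplit : Icc t T = A ∪ (Icc t T \ A) := (union_sdiff_cancel fun s hs => hs.1).symm
    rw [hsplit, aestronglyMeasurable_union_iff]
    refine ⟨hAc.aestronglyMeasurable hAord.measurableSet, ?_⟩
    refine ContinuousOn.aestronglyMeasurable ?_ (measurableSet_Icc.diff hAord.measurableSet)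
    exact continuousOn_const.congr fun s hs => hcompl s hs.1 hs.2
  exact ⟨hbound, hd.integrableOn_comp hFcont hDcomp hmeas hbound⟩

theorem IsTraj.eqOn (hLF : 0 ≤ LF)
    (hFcont : Continuous fun p : EucSp n × EucSp m => F p.1 p.2) (hDcomp : IsCompact D)
    (hFlip : ∀ x y : EucSp n, ∀ d ∈ D, ‖F x d - F y d‖ ≤ LF * ‖x - y‖)
    (hd : Admissible D t T d) (hy : IsTraj F d t T x y) (hz : IsTraj F d t T x z) :
    EqOn y z (Icc t T) := by
  obtain ⟨M, hM0, hM⟩ := exists_norm_le_of_norm_sub_le hFcont hDcomp x 0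
  have hMx : ∀ b ∈ D, ‖F x b‖ ≤ M := fun b hb => hM x b (by simp) hb
  have hyi := (hy.norm_sub_le_and_integrableOn hLF hFcont hDcomp hFlip hM0 hMx hd).2
  have hzi := (hz.norm_sub_le_and_integrableOn hLF hFcont hDcomp hFlip hM0 hMx hd).2
  have hc : ContinuousOn (fun s => ‖y s - z s‖) (Icc t T) :=
    ((hy.continuousOn hyi).sub (hz.continuousOn hzi)).norm
  have hle := le_mul_exp_of_le_add_mul_integral (δ := 0) hLF hc fun s hs => by
    have hsub : Icc t s ⊆ Icc t T := Icc_subset_Icc_right hs.2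
    have hii : ∀ {φ : ℝ → EucSp n}, IntegrableOn φ (Icc t T) → IntervalIntegrable φ volume t s :=
      fun hφ => (intervalIntegrable_iff_integrableOn_Icc_of_le hs.1).2 (hφ.mono_set hsub)
    rw [hy.2 s hs, hz.2 s hs, add_sub_add_left_eq_sub,
      ← intervalIntegral.integral_sub (hii hyi) (hii hzi), zero_add,
      ← intervalIntegral.integral_const_mul]
    refine intervalIntegral.norm_integral_le_of_norm_le hs.1 (ae_of_all _ fun r hr => ?_)
      (((hc.mono hsub).intervalIntegrable_of_Icc hs.1).const_mul LF)
    exact hFlip _ _ _ (hd.2 r ⟨hr.1.le, hr.2.trans hs.2⟩)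
  intro s hs
  have := hle s hs
  rw [zero_mul] at this
  exact sub_eq_zero.1 (norm_le_zero_iff.1 this)

/-- Carathéodory existence: some iterate of the Picard operator is a contraction. -/
theorem Admissible.exists_isTraj (hLF : 0 ≤ LF) (htT : t ≤ T)
    (hFcont : Continuous fun p : EucSp n × EucSp m => F p.1 p.2) (hDcomp : IsCompact D)
    (hFlip : ∀ x y : EucSp n, ∀ d ∈ D, ‖F x d - F y d‖ ≤ LF * ‖x - y‖)
    (hd : Admissible D t T d) (x : EucSp n) : ∃ y, IsTraj F d t T x y := by
  have hint : ∀ α : C(Icc t T, EucSp n),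
      IntegrableOn (fun r => F (IccExtend htT α r) (d r)) (Icc t T) := fun α =>
    hd.integrableOn_comp_of_continuousOn hFcont hDcomp α.continuous.Icc_extend'.continuousOn
  have hii : ∀ α : C(Icc t T, EucSp n), ∀ s : Icc t T,
      IntervalIntegrable (fun r => F (IccExtend htT α r) (d r)) volume t s := fun α s =>
    (intervalIntegrable_iff_integrableOn_Icc_of_le s.2.1).2
      ((hint α).mono_set (Icc_subset_Icc_right s.2.2))
  let P : C(Icc t T, EucSp n) → C(Icc t T, EucSp n) := fun α =>
    ⟨fun s => x + ∫ r in t..s, F (IccExtend htT α r) (d r),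
      continuous_const.add
        (continuousOn_intervalIntegral_Icc (hint α)).domRestrict⟩
  have hP : ∀ α s, P α s = x + ∫ r in t..s, F (IccExtend htT α r) (d r) := fun _ _ => rfl
  have hiter : ∀ (k : ℕ) (α β : C(Icc t T, EucSp n)) (s : Icc t T),
      ‖P^[k] α s - P^[k] β s‖ ≤ (LF * (s - t)) ^ k / k.factorial * dist α β := by
    intro k α β
    induction k with
    | zero =>
      intro s
      simpa [dist_eq_norm] using ContinuousMap.dist_apply_le_dist (f := α) (g := β) s
    | succ k ih =>
      intro s
      rw [Function.iterate_succ_apply', Function.iterate_succ_apply', hP, hP,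
        add_sub_add_left_eq_sub, ← intervalIntegral.integral_sub (hii _ s) (hii _ s)]
      calc _ ≤ ∫ r in t..s, LF ^ (k + 1) / k.factorial * dist α β * (r - t) ^ k := by
            refine intervalIntegral.norm_integral_le_of_norm_le s.2.1 (ae_of_all _ fun r hr => ?_)
              (Continuous.intervalIntegrable (by fun_prop) _ _)
            have hr' : r ∈ Icc t T := ⟨hr.1.le, hr.2.trans s.2.2⟩
            rw [IccExtend_of_mem _ _ hr', IccExtend_of_mem _ _ hr']
            refine (hFlip _ _ _ (hd.2 r hr')).trans
              ((mul_le_mul_of_nonneg_left (ih ⟨r, hr'⟩) hLF).trans_eq ?_)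
            rw [mul_pow]
            ring
        _ = (LF * (s - t)) ^ (k + 1) / (k + 1).factorial * dist α β := by
            rw [intervalIntegral.integral_const_mul,
              intervalIntegral.integral_comp_sub_right (fun r => r ^ k), integral_pow,
              Nat.factorial_succ]
            push_cast
            rw [sub_self, mul_pow]
            field_simp
            simp
  obtain ⟨k, hk⟩ := (FloorSemiring.tendsto_pow_div_factorial_atTop (LF * (T - t))).eventually
    (gt_mem_nhds zero_lt_one) |>.exists
  have hnonneg : 0 ≤ (LF * (T - t)) ^ k / (k.factorial : ℝ) := by
    have := sub_nonneg.2 htT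
    positivity
  have hcontr : ContractingWith (.mk _ hnonneg) P^[k] := by
    refine ⟨hk, LipschitzWith.of_dist_le_mul fun α β => ?_⟩
    rw [NNReal.coe_mk, ContinuousMap.dist_le (mul_nonneg hnonneg dist_nonneg)]
    intro s
    rw [dist_eq_norm]
    refine (hiter k α β s).trans ?_
    have h1 := sub_nonneg.2 s.2.1
    have h2 := s.2.2
    gcongr
  have hfix := hcontr.isFixedPt_fixedPoint_iterate
  set α := hcontr.fixedPoint P^[k]
  have hsol : ∀ s ∈ Icc t T,
      IccExtend htT α s = x + ∫ r in t..s, F (IccExtend htT α r) (d r) := by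
    intro s hs
    rw [IccExtend_of_mem _ _ hs, ← hP α ⟨s, hs⟩, hfix.eq]
  exact ⟨IccExtend htT α, by simpa using hsol t (left_mem_Icc.2 htT), hsol⟩

/-- Two dynamics that agree along `y` have `y` as a common trajectory. -/
theorem IsTraj.congr {G : EucSp n → EucSp m → EucSp n} (h : IsTraj F d t T x y)
    (hFG : ∀ r ∈ Icc t T, F (y r) (d r) = G (y r) (d r)) : IsTraj G d t T x y := by
  refine ⟨h.1, fun s hs => ?_⟩
  rw [h.2 s hs, intervalIntegral.integral_congr]
  rw [uIcc_of_le hs.1]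
  exact fun r hr => hFG r (Icc_subset_Icc_right hs.2 hr)

end Trajectories

section Payoff

variable {n nX nTR : ℕ} {g : Fin nX → EucSp n → ℝ → ℝ} {l : Fin nTR → EucSp n → ℝ}
  {t T : ℝ} {y : ℝ → EucSp n}

theorem payoff_le {C : ℝ} (hC : 0 ≤ C) (hl : ∀ j, l j (y T) ≤ C)
    (hg : ∀ s ∈ Icc t T, ∀ i, g i (y s) s ≤ C) : payoff g l t T y ≤ C := by
  refine max_le (Real.iSup_le hl hC) (Real.iSup_le (fun i => Real.sSup_le ?_ hC) hC)
  rintro _ ⟨s, hs, rfl⟩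
  exact hg s hs i

theorem le_payoff_terminal (j : Fin nTR) : l j (y T) ≤ payoff g l t T y :=
  le_max_of_le_left (le_ciSup (f := fun j => l j (y T)) (finite_range _).bddAbove j)

theorem le_payoff_running (hg : ∀ i, Continuous fun p : EucSp n × ℝ => g i p.1 p.2)
    (hy : ContinuousOn y (Icc t T)) (i : Fin nX) {s : ℝ} (hs : s ∈ Icc t T) :
    g i (y s) s ≤ payoff g l t T y := by
  have hbdd : BddAbove ((fun s => g i (y s) s) '' Icc t T) :=
    (isCompact_Icc.image_of_continuousOn
      ((hg i).comp_continuousOn (hy.prodMk continuousOn_id))).bddAbove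
  exact le_max_of_le_right ((le_csSup hbdd (mem_image_of_mem _ hs)).trans
    (le_ciSup (f := fun i => sSup ((fun s => g i (y s) s) '' Icc t T))
      (finite_range _).bddAbove i))

/-- The payoff is bounded over curves staying in a fixed ball. -/
theorem exists_payoff_le (hg : ∀ i, Continuous fun p : EucSp n × ℝ => g i p.1 p.2)
    (hl : ∀ j, Continuous (l j)) (htT : t ≤ T) (x : EucSp n) (C : ℝ) :
    ∃ M, ∀ y : ℝ → EucSp n, (∀ s ∈ Icc t T, ‖y s - x‖ ≤ C) → payoff g l t T y ≤ M := by
  choose a ha using fun i => ((isCompact_closedBall x C).prod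
    (isCompact_Icc (a := t) (b := T))).exists_bound_of_continuousOn (hg i).continuousOn
  choose b hb using fun j => (isCompact_closedBall x C).exists_bound_of_continuousOn
    (hl j).continuousOn
  have hsum : ∀ {k : ℕ} (c : Fin k → ℝ) i, c i ≤ ∑ i, |c i| := fun c i =>
    (le_abs_self _).trans
      (Finset.single_le_sum (f := fun i => |c i|) (fun _ _ => abs_nonneg _) (Finset.mem_univ i))
  have ha0 : 0 ≤ ∑ i, |a i| := Finset.sum_nonneg fun _ _ => abs_nonneg _
  have hb0 : 0 ≤ ∑ j, |b j| := Finset.sum_nonneg fun _ _ => abs_nonneg _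
  refine ⟨∑ i, |a i| + ∑ j, |b j|, fun y hy => payoff_le (add_nonneg ha0 hb0) ?_ ?_⟩
  · intro j
    have := hb j (y T) (mem_closedBall_iff_norm.2 (hy T (right_mem_Icc.2 htT)))
    linarith [(le_abs_self (l j (y T))), hsum b j, Real.norm_eq_abs (l j (y T))]
  · intro s hs i
    have := ha i (y s, s) ⟨mem_closedBall_iff_norm.2 (hy s hs), hs⟩
    linarith [(le_abs_self (g i (y s) s)), hsum a i, Real.norm_eq_abs (g i (y s) s)]

end Payoff

/-- For every `t ∈ [0, T]`, the backward reachable set `ℛ_t` equals the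
zero sub-level set of the value function: `ℛ_t = {x | u(x, t) ≤ 0}`. -/
theorem stmt0
    {n m nX nTR : ℕ} (hn : 0 < n) (hm : 0 < m) (hnX : 0 < nX) (hnTR : 0 < nTR)
    (T : ℝ) (hT : 0 < T)
    (D : Set (EucSp m)) (hDne : D.Nonempty) (hDcomp : IsCompact D)
    (F : EucSp n → EucSp m → EucSp n)
    (hFcont : Continuous fun p : EucSp n × EucSp m => F p.1 p.2)
    (LF : ℝ) (hLF : 0 ≤ LF)
    (hFlip : ∀ x y : EucSp n, ∀ d ∈ D, ‖F x d - F y d‖ ≤ LF * ‖x - y‖)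
    (g : Fin nX → EucSp n → ℝ → ℝ) (l : Fin nTR → EucSp n → ℝ)
    (hg : ∀ i, LocallyLipschitz fun p : EucSp n × ℝ => g i p.1 p.2)
    (hl : ∀ j, LocallyLipschitz (l j))
    (u : EucSp n → ℝ → ℝ) (hu : IsValueFun F D g l T u)
    (f : EucSp n → EucSp m → EucSp n)
    (hfcont : Continuous fun p : EucSp n × EucSp m => f p.1 p.2)
    (hflip : ∀ K : Set (EucSp n), IsCompact K → ∃ L, 0 ≤ L ∧
      ∀ x ∈ K, ∀ y ∈ K, ∀ d ∈ D, ‖f x d - f y d‖ ≤ L * ‖x - y‖)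
    (R : ℝ) (hR : 0 < R)
    (Bset : Set (EucSp n)) (hB : Bset = {x : EucSp n | ∑ i, x i ^ 2 ≤ R})
    (hFf : ∀ x ∈ Bset, ∀ d ∈ D, F x d = f x d)
    (hXB : ∀ t ∈ Set.Icc (0:ℝ) T, {x : EucSp n | ∀ i, g i x t ≤ 0} ⊆ Bset)
    (hTRB : {x : EucSp n | ∀ j, l j x ≤ 0} ⊆ Bset)
 :
    ∀ t ∈ Set.Icc (0:ℝ) T, Reach f D g l t T = {x : EucSp n | u x t ≤ 0} := by
  intro t ht
  have hgc : ∀ i, Continuous fun p : EucSp n × ℝ => g i p.1 p.2 := fun i => (hg i).continuous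
  have hmemB : ∀ s ∈ Icc t T, ∀ a, (∀ i, g i a s ≤ 0) → a ∈ Bset := fun s hs a ha =>
    hXB s ⟨ht.1.trans hs.1, hs.2⟩ ha
  ext x
  rw [mem_ofPred_eq, hu x t ht]
  constructor
  · intro hx
    refine Real.sSup_nonpos ?_
    rintro _ ⟨d, y, hd, hy, rfl⟩
    obtain ⟨z, hz, hzg, hzl⟩ := hx d hd
    have hzF : IsTraj F d t T x z :=
      hz.congr fun r hr => (hFf _ (hmemB r hr _ (hzg r hr)) _ (hd.2 r hr)).symm
    have hyz := hy.eqOn hLF hFcont hDcomp hFlip hd hzF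
    refine payoff_le le_rfl (fun j => ?_) fun s hs i => ?_
    · rw [hyz (right_mem_Icc.2 ht.2)]
      exact hzl j
    · rw [hyz hs]
      exact hzg s hs i
  · intro hx d hd
    obtain ⟨M, hM0, hM⟩ := exists_norm_le_of_norm_sub_le hFcont hDcomp x 0
    have hMx : ∀ b ∈ D, ‖F x b‖ ≤ M := fun b hb => hM x b (by simp) hb
    obtain ⟨y, hy⟩ := hd.exists_isTraj hLF ht.2 hFcont hDcomp hFlip x
    have hyc := hy.continuousOn
      (hy.norm_sub_le_and_integrableOn hLF hFcont hDcomp hFlip hM0 hMx hd).2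
    obtain ⟨C, hC⟩ := exists_payoff_le hgc (fun j => (hl j).continuous) ht.2 x
      (M * (T - t) * Real.exp (LF * (T - t)))
    have hpay : payoff g l t T y ≤ 0 := by
      refine le_trans ?_ hx
      refine le_csSup ⟨C, ?_⟩ ⟨d, y, hd, hy, rfl⟩
      rintro _ ⟨d', z, hd', hz, rfl⟩
      exact hC z (hz.norm_sub_le_and_integrableOn hLF hFcont hDcomp hFlip hM0 hMx hd').1
    have hyg : ∀ s ∈ Icc t T, ∀ i, g i (y s) s ≤ 0 := fun s hs i =>
      (le_payoff_running hgc hyc i hs).trans hpay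
    exact ⟨y, hy.congr fun r hr => hFf _ (hmemB r hr _ (hyg r hr)) _ (hd.2 r hr), hyg,
      fun j => (le_payoff_terminal j).trans hpay⟩

end
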